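/- arXiv:2002.10669 — 9 statements merged into one kernel-verified Lean document; each statement's English description precedes it below -/
import Mathlib

section
/- Let f : (0,1) → ℝ be continuously differentiable and satisfy f′(p) = ((1−p)/p)·f′(1−p) for all p ∈ (1/2, 1). If f′ is nonnegative on (0, 1/2], then f is weakly proper; if moreover f′ is strictly positive almost everywhere on (0, 1/2], then f is proper. -/
open MeasureTheory Set

noncomputable def rewardFn (f : ℝ → ℝ) : ℝ → ℝ := fun x => x * f x + (1 - x) * f (1 - x)

/-- `f` is a (strictly) proper scoring rule: for every belief `p ∈ (0,1)`,
the expected reward `x ↦ p·f(x) + (1−p)·f(1−x)` is strictly maximized over `(0,1)` at `x = p`. -/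
def IsProperRule (f : ℝ → ℝ) : Prop :=
  ∀ p ∈ Set.Ioo (0:ℝ) 1, ∀ x ∈ Set.Ioo (0:ℝ) 1, x ≠ p →
    p * f x + (1 - p) * f (1 - x) < p * f p + (1 - p) * f (1 - p)

/-- `f` is a weakly proper scoring rule: for every belief `p ∈ (0,1)`,
the expected reward `x ↦ p·f(x) + (1−p)·f(1−x)` is (weakly) maximized over `(0,1)` at `x = p`. -/
def IsWeaklyProperRule (f : ℝ → ℝ) : Prop :=
  ∀ p ∈ Set.Ioo (0:ℝ) 1, ∀ x ∈ Set.Ioo (0:ℝ) 1,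
    p * f x + (1 - p) * f (1 - x) ≤ p * f p + (1 - p) * f (1 - p)

/-- The derivative of the expected reward `x ↦ p·f(x) + (1−p)·f(1−x)`, when `f` satisfies
the symmetry `x·f′(x) = (1−x)·f′(1−x)`. -/
lemma hasDerivAt_expectedReward {f : ℝ → ℝ} (hd : ∀ x ∈ Ioo (0:ℝ) 1, DifferentiableAt ℝ f x)
    (hsymm : ∀ x ∈ Ioo (0:ℝ) 1, x * deriv f x = (1 - x) * deriv f (1 - x))
    (p : ℝ) {x : ℝ} (hx : x ∈ Ioo (0:ℝ) 1) :
    HasDerivAt (fun x => p * f x + (1 - p) * f (1 - x)) (deriv f x * (p - x) / (1 - x)) x := by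
  have hx' : (1 - x) ∈ Ioo (0:ℝ) 1 := ⟨by linarith [hx.2], by linarith [hx.1]⟩
  have h1 := (hd x hx).hasDerivAt.const_mul p
  have h2 := ((hd _ hx').hasDerivAt.comp x ((hasDerivAt_id x).const_sub 1)).const_mul (1 - p)
  refine (h1.add h2).congr_deriv ?_
  have h3 : (1 - x) ≠ 0 := hx'.1.ne'
  have h4 := hsymm x hx
  field_simp
  linear_combination (1 - p) * h4

lemma mul_deriv_symm_of_extension {f : ℝ → ℝ}
    (hext : ∀ p ∈ Ioo (1/2 : ℝ) 1, deriv f p = ((1 - p) / p) * deriv f (1 - p)) :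
    ∀ x ∈ Ioo (0:ℝ) 1, x * deriv f x = (1 - x) * deriv f (1 - x) := by
  have key : ∀ p ∈ Ioo (1/2 : ℝ) 1, p * deriv f p = (1 - p) * deriv f (1 - p) := by
    intro p hp
    have : p ≠ 0 := by linarith [hp.1]
    rw [hext p hp]
    field_simp
  intro x hx
  rcases lt_trichotomy x (1/2) with h | rfl | h
  · have := key (1 - x) ⟨by linarith, by linarith [hx.1]⟩
    rw [sub_sub_cancel] at this
    exact this.symm
  · norm_num
  · exact key x ⟨h, hx.2⟩

lemma expectedReward_monotoneOn {f : ℝ → ℝ} (hd : ∀ x ∈ Ioo (0:ℝ) 1, DifferentiableAt ℝ f x)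
    (hsymm : ∀ x ∈ Ioo (0:ℝ) 1, x * deriv f x = (1 - x) * deriv f (1 - x))
    (hnonneg : ∀ x ∈ Ioo (0:ℝ) 1, 0 ≤ deriv f x) {p : ℝ} (hp : p ∈ Ioo (0:ℝ) 1) :
    MonotoneOn (fun x => p * f x + (1 - p) * f (1 - x)) (Ioc 0 p) := by
  have hg : ∀ x ∈ Ioc 0 p, HasDerivAt (fun x => p * f x + (1 - p) * f (1 - x))
      (deriv f x * (p - x) / (1 - x)) x := fun x hx =>
    hasDerivAt_expectedReward hd hsymm p ⟨hx.1, hx.2.trans_lt hp.2⟩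
  refine monotoneOn_of_hasDerivWithinAt_nonneg (convex_Ioc 0 p)
    (fun x hx => (hg x hx).continuousAt.continuousWithinAt)
    (fun x hx => (hg x (interior_subset hx)).hasDerivWithinAt) fun x hx => ?_
  have hx := interior_subset hx
  exact div_nonneg (mul_nonneg (hnonneg x ⟨hx.1, hx.2.trans_lt hp.2⟩) (by linarith [hx.2]))
    (by linarith [hx.2, hp.2])

lemma expectedReward_strictMonoOn {f : ℝ → ℝ}
    (hd : ∀ x ∈ Ioo (0:ℝ) 1, DifferentiableAt ℝ f x)
    (hsymm : ∀ x ∈ Ioo (0:ℝ) 1, x * deriv f x = (1 - x) * deriv f (1 - x))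
    (hnonneg : ∀ x ∈ Ioo (0:ℝ) 1, 0 ≤ deriv f x)
    (hpos : ∀ a b : ℝ, 0 < a → a < b → b < 1 → ∃ c ∈ Ioo a b, 0 < deriv f c)
    {p : ℝ} (hp : p ∈ Ioo (0:ℝ) 1) :
    StrictMonoOn (fun x => p * f x + (1 - p) * f (1 - x)) (Ioc 0 p) := by
  have hmono := expectedReward_monotoneOn hd hsymm hnonneg hp
  intro x hx y hy hxy
  refine (hmono hx hy hxy.le).lt_of_ne fun heq => ?_
  obtain ⟨c, hc, hfc⟩ := hpos x y hx.1 hxy (hy.2.trans_lt hp.2)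
  have hcp : c < p := hc.2.trans_le hy.2
  have hderiv := hasDerivAt_expectedReward hd hsymm p
    (show c ∈ Ioo (0:ℝ) 1 from ⟨hx.1.trans hc.1, hcp.trans hp.2⟩)
  have hconst : (fun x => p * f x + (1 - p) * f (1 - x)) =ᶠ[nhds c]
      fun _ => p * f x + (1 - p) * f (1 - x) := by
    filter_upwards [Ioo_mem_nhds hc.1 hc.2] with z hz
    have hzm : z ∈ Ioc 0 p := ⟨hx.1.trans hz.1, hz.2.le.trans hy.2⟩
    exact le_antisymm ((hmono hzm hy hz.2.le).trans_eq heq.symm) (hmono hx hzm hz.1.le)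
  have hzero := hderiv.unique ((hasDerivAt_const c _).congr_of_eventuallyEq hconst)
  have : 0 < deriv f c * (p - c) / (1 - c) :=
    div_pos (mul_pos hfc (by linarith)) (by linarith [hp.2])
  exact this.ne' hzero

lemma exists_deriv_pos_of_ae {f : ℝ → ℝ}
    (hsymm : ∀ x ∈ Ioo (0:ℝ) 1, x * deriv f x = (1 - x) * deriv f (1 - x))
    (hae : ∀ᵐ x ∂(volume.restrict (Ioc (0:ℝ) (1/2))), 0 < deriv f x)
    (a b : ℝ) (ha : 0 < a) (hab : a < b) (hb : b < 1) : ∃ c ∈ Ioo a b, 0 < deriv f c := by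
  have key : ∀ a b : ℝ, 0 < a → a < b → b ≤ 1/2 → ∃ c ∈ Ioo a b, 0 < deriv f c := by
    intro a b ha hab hb
    have h := ae_restrict_of_ae_restrict_of_subset
      (show Ioo a b ⊆ Ioc (0:ℝ) (1/2) from fun x hx => ⟨ha.trans hx.1, hx.2.le.trans hb⟩) hae
    by_contra! hcon
    rw [ae_restrict_iff' measurableSet_Ioo] at h
    have h0 : volume (Ioo a b) = 0 := by
      refine measure_mono_null ?_ (ae_iff.1 h)
      exact fun x hx hxpos => (hcon x hx).not_gt (hxpos hx)
    rw [Real.volume_Ioo, ENNReal.ofReal_eq_zero] at h0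
    linarith
  rcases lt_or_ge a (1/2) with h | h
  · obtain ⟨c, hc, hfc⟩ := key a (min b (1/2)) ha (lt_min hab h) (min_le_right _ _)
    exact ⟨c, ⟨hc.1, hc.2.trans_le (min_le_left _ _)⟩, hfc⟩
  · obtain ⟨c, hc, hfc⟩ := key (1 - b) (1 - a) (by linarith) (by linarith) (by linarith)
    have hc0 : 0 < c := by linarith [hc.1]
    have hc1 : 0 < 1 - c := by linarith [hc.2]
    refine ⟨1 - c, ⟨by linarith [hc.2], by linarith [hc.1]⟩, ?_⟩
    refine pos_of_mul_pos_right ?_ hc1.le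
    rw [← hsymm c ⟨hc0, by linarith⟩]
    exact mul_pos hc0 hfc

theorem extension_is_proper (f : ℝ → ℝ) (hf : ContDiffOn ℝ 1 f (Set.Ioo 0 1))
    (hext : ∀ p ∈ Set.Ioo (1/2 : ℝ) 1, deriv f p = ((1 - p) / p) * deriv f (1 - p)) :
    ((∀ x ∈ Set.Ioc (0:ℝ) (1/2), 0 ≤ deriv f x) → IsWeaklyProperRule f) ∧
    ((∀ x ∈ Set.Ioc (0:ℝ) (1/2), 0 ≤ deriv f x) →
      (∀ᵐ x ∂(volume.restrict (Set.Ioc (0:ℝ) (1/2))), 0 < deriv f x) → IsProperRule f) := by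
  have hd : ∀ x ∈ Ioo (0:ℝ) 1, DifferentiableAt ℝ f x := fun x hx =>
    (hf.differentiableOn one_ne_zero).differentiableAt (Ioo_mem_nhds hx.1 hx.2)
  have hsymm := mul_deriv_symm_of_extension hext
  have hnonneg : (∀ x ∈ Ioc (0:ℝ) (1/2), 0 ≤ deriv f x) → ∀ x ∈ Ioo (0:ℝ) 1, 0 ≤ deriv f x := by
    intro h x hx
    rcases le_or_gt x (1/2) with hx2 | hx2
    · exact h x ⟨hx.1, hx2⟩
    · rw [hext x ⟨hx2, hx.2⟩]
      exact mul_nonneg (div_nonneg (by linarith [hx.2]) hx.1.le)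
        (h _ ⟨by linarith [hx.2], by linarith⟩)
  have hreflect : ∀ x ∈ Ioo (0:ℝ) 1, 1 - x ∈ Ioo (0:ℝ) 1 := fun x hx =>
    ⟨by linarith [hx.2], by linarith [hx.1]⟩
  refine ⟨fun h p hp x hx => ?_, fun h hae p hp x hx hne => ?_⟩
  · rcases le_total x p with hxp | hxp
    · exact expectedReward_monotoneOn hd hsymm (hnonneg h) hp ⟨hx.1, hxp⟩ ⟨hp.1, le_rfl⟩ hxp
    · have := expectedReward_monotoneOn hd hsymm (hnonneg h) (hreflect p hp)
        ⟨(hreflect x hx).1, by linarith⟩ ⟨(hreflect p hp).1, le_rfl⟩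
        (show 1 - x ≤ 1 - p by linarith)
      simp only [sub_sub_cancel] at this
      linarith
  · have hpos := exists_deriv_pos_of_ae hsymm hae
    rcases hne.lt_or_gt with hxp | hxp
    · exact expectedReward_strictMonoOn hd hsymm (hnonneg h) hpos hp
        ⟨hx.1, hxp.le⟩ ⟨hp.1, le_rfl⟩ hxp
    · have := expectedReward_strictMonoOn hd hsymm (hnonneg h) hpos (hreflect p hp)
        ⟨(hreflect x hx).1, by linarith⟩ ⟨(hreflect p hp).1, le_rfl⟩
        (show 1 - x < 1 - p by linarith)
      simp only [sub_sub_cancel] at this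
      linarith
end

section
/- Let f : (0,1) → ℝ be a continuously differentiable weakly proper scoring rule, and let R^f(x) := x·f(x) + (1−x)·f(1−x). Then R^f is twice differentiable on (0,1), and for every x ∈ (0,1): (R^f)′(x) = f(x) − f(1−x), and (R^f)″(x) = f′(x) + f′(1−x) = f′(x)/(1−x) ≥ 0. -/
open MeasureTheory Set

lemma HasDerivAt.comp_one_sub {g : ℝ → ℝ} {g' x : ℝ} (hg : HasDerivAt g g' (1 - x)) :
    HasDerivAt (fun y => g (1 - y)) (-g') x := by
  simpa [Function.comp_def] using hg.comp x ((hasDerivAt_id x).const_sub 1)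

/-- The first order condition satisfied by a differentiable weakly proper scoring rule. -/
lemma IsWeaklyProperRule.mul_deriv_eq {f : ℝ → ℝ} (hw : IsWeaklyProperRule f)
    (hd : ∀ x ∈ Set.Ioo (0:ℝ) 1, HasDerivAt f (deriv f x) x) {x : ℝ}
    (hx : x ∈ Set.Ioo (0:ℝ) 1) : x * deriv f x = (1 - x) * deriv f (1 - x) := by
  have hr := ((hd x hx).const_mul x).add
    ((hd (1 - x) (by simpa [and_comm] using hx)).comp_one_sub.const_mul (1 - x))
  have hmax : IsLocalMax ((fun y => x * f y) + fun y => (1 - x) * f (1 - y)) x := by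
    filter_upwards [Ioo_mem_nhds hx.1 hx.2] with y hy using hw x hx y hy
  linarith [hmax.hasDerivAt_eq_zero hr]

lemma IsWeaklyProperRule.monotoneOn {f : ℝ → ℝ} (hw : IsWeaklyProperRule f) :
    MonotoneOn (fun x => f x - f (1 - x)) (Set.Ioo 0 1) := by
  intro x hx y hy hxy
  rcases hxy.eq_or_lt with rfl | hlt
  · rfl
  · have h : 0 ≤ (y - x) * ((f y - f (1 - y)) - (f x - f (1 - x))) := by
      linarith [hw x hx y hy, hw y hy x hx]
    exact sub_nonneg.mp (nonneg_of_mul_nonneg_right h (sub_pos.mpr hlt))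

theorem rewardFn_deriv (f : ℝ → ℝ) (hf : ContDiffOn ℝ 1 f (Set.Ioo 0 1))
    (hw : IsWeaklyProperRule f) :
    ∀ x ∈ Set.Ioo (0:ℝ) 1,
      HasDerivAt (rewardFn f) (f x - f (1 - x)) x ∧
      HasDerivAt (deriv (rewardFn f)) (deriv f x + deriv f (1 - x)) x ∧
      deriv f x + deriv f (1 - x) = deriv f x / (1 - x) ∧
      0 ≤ deriv f x + deriv f (1 - x) := by
  have hd : ∀ x ∈ Set.Ioo (0:ℝ) 1, HasDerivAt f (deriv f x) x := fun x hx =>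
    ((hf.differentiableOn one_ne_zero).differentiableAt (Ioo_mem_nhds hx.1 hx.2)).hasDerivAt
  have hsymm : ∀ x ∈ Set.Ioo (0:ℝ) 1, 1 - x ∈ Set.Ioo (0:ℝ) 1 := fun x hx => by
    simpa [and_comm] using hx
  have hR : ∀ x ∈ Set.Ioo (0:ℝ) 1, HasDerivAt (rewardFn f) (f x - f (1 - x)) x := by
    intro x hx
    have h := ((hasDerivAt_id x).mul (hd x hx)).add
      (((hasDerivAt_id x).const_sub 1).mul (hd _ (hsymm x hx)).comp_one_sub)
    refine h.congr_deriv ?_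
    simp only [id]
    linarith [hw.mul_deriv_eq hd hx]
  intro x hx
  have hG : HasDerivAt (fun y => f y - f (1 - y)) (deriv f x + deriv f (1 - x)) x :=
    ((hd x hx).sub (hd _ (hsymm x hx)).comp_one_sub).congr_deriv (sub_neg_eq_add _ _)
  have hnhds : Set.Ioo (0:ℝ) 1 ∈ nhds x := Ioo_mem_nhds hx.1 hx.2
  refine ⟨hR x hx, hG.congr_of_eventuallyEq ?_, ?_, ?_⟩
  · filter_upwards [hnhds] with y hy using (hR y hy).deriv
  · rw [eq_div_iff (sub_pos.mpr hx.2).ne']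
    linarith [hw.mul_deriv_eq hd hx]
  · rw [← hG.deriv, ← derivWithin_of_mem_nhds hnhds]
    exact hw.monotoneOn.derivWithin_nonneg
end

section
/- Let f : (0,1) → ℝ be a continuously differentiable proper scoring rule with reward function R := R^f. Then for all natural numbers n and k with 0 ≤ k ≤ n, one has ((k+1)/(n+2))·R((k+2)/(n+3)) + ((n−k+1)/(n+2))·R((k+1)/(n+3)) − R((k+1)/(n+2)) > 0. -/
open MeasureTheory Set

/-- The reward function of a proper scoring rule is strictly convex. -/
theorem IsProperRule.strictConvexOn_rewardFn {f : ℝ → ℝ} (hp : IsProperRule f) :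
    StrictConvexOn ℝ (Set.Ioo 0 1) (rewardFn f) := by
  refine ⟨convex_Ioo 0 1, fun x hx y hy hxy a b ha hb hab => ?_⟩
  have hm : a • x + b • y ∈ Set.Ioo (0 : ℝ) 1 := convex_Ioo 0 1 hx hy ha.le hb.le hab
  obtain rfl : b = 1 - a := by linarith
  simp only [smul_eq_mul, rewardFn] at hm ⊢
  set m := a * x + (1 - a) * y with hmdef
  have hmx : m ≠ x := fun h =>
    mul_ne_zero hb.ne' (sub_ne_zero.2 hxy) (by linear_combination hmdef - h)
  have hmy : m ≠ y := fun h =>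
    mul_ne_zero ha.ne' (sub_ne_zero.2 hxy) (by linear_combination h - hmdef)
  have h₁ := mul_lt_mul_of_pos_left (hp x hx m hm hmx) ha
  have h₂ := mul_lt_mul_of_pos_left (hp y hy m hm hmy) hb
  have h₃ : m * f m + (1 - m) * f (1 - m) =
      a * (x * f m + (1 - x) * f (1 - m)) + (1 - a) * (y * f m + (1 - y) * f (1 - m)) := by
    linear_combination (f m - f (1 - m)) * hmdef
  linarith

theorem increase_in_reward_pos (f : ℝ → ℝ) (hf : ContDiffOn ℝ 1 f (Set.Ioo 0 1))
    (hp : IsProperRule f) (n k : ℕ) (hk : k ≤ n) :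
    0 < ((k:ℝ) + 1) / ((n:ℝ) + 2) * rewardFn f (((k:ℝ) + 2) / ((n:ℝ) + 3))
        + ((n:ℝ) - (k:ℝ) + 1) / ((n:ℝ) + 2) * rewardFn f (((k:ℝ) + 1) / ((n:ℝ) + 3))
        - rewardFn f (((k:ℝ) + 1) / ((n:ℝ) + 2)) := by
  have hkn : (k : ℝ) ≤ n := by exact_mod_cast hk
  have hk0 : (0 : ℝ) ≤ k := k.cast_nonneg
  have hn₂ : (0 : ℝ) < n + 2 := by linarith
  have hn₃ : (0 : ℝ) < n + 3 := by linarith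
  have hx : ((k : ℝ) + 2) / (n + 3) ∈ Set.Ioo (0 : ℝ) 1 :=
    ⟨by positivity, by rw [div_lt_one hn₃]; linarith⟩
  have hy : ((k : ℝ) + 1) / (n + 3) ∈ Set.Ioo (0 : ℝ) 1 :=
    ⟨by positivity, by rw [div_lt_one hn₃]; linarith⟩
  have hxy : ((k : ℝ) + 2) / (n + 3) ≠ (k + 1) / (n + 3) := by
    rw [Ne, div_left_inj' hn₃.ne']
    intro h
    linarith
  have ha : 0 < ((k : ℝ) + 1) / (n + 2) := by positivity
  have hb : 0 < ((n : ℝ) - k + 1) / (n + 2) := div_pos (by linarith) hn₂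
  have hab : ((k : ℝ) + 1) / (n + 2) + ((n : ℝ) - k + 1) / (n + 2) = 1 := by
    field_simp
    ring
  have hconv := hp.strictConvexOn_rewardFn.2 hx hy hxy ha hb hab
  have hmean : ((k : ℝ) + 1) / (n + 2) * ((k + 2) / (n + 3)) +
      ((n : ℝ) - k + 1) / (n + 2) * ((k + 1) / (n + 3)) = (k + 1) / (n + 2) := by
    field_simp
    ring
  simp only [smul_eq_mul, hmean] at hconv
  linarith
end

section
/- Let f : (0,1) → ℝ be a continuously differentiable weakly proper scoring rule with reward function R := R^f, and assume R is Lebesgue integrable on (0,1), f is integrable on (1/2, 1), and x ↦ (1−x)·f′(x) is integrable on (1/2, 1). Then ∫₀¹ R(x) dx = f(1/2) + ∫_{1/2}^1 (1−x)·f′(x) dx = (1/2)·f(1/2) + ∫_{1/2}^1 f(x) dx. -/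
open MeasureTheory Set

open Filter Topology Asymptotics in
/-- If `(1 - x) * u x` has a limit as `x → 1⁻` and `u` is integrable up to `1`, the limit is `0`. -/
theorem eq_zero_of_tendsto_one_sub_mul {u : ℝ → ℝ} {a L : ℝ} (ha : a < 1)
    (hu : IntervalIntegrable u volume a 1)
    (hL : Tendsto (fun x => (1 - x) * u x) (𝓝[<] 1) (𝓝 L)) : L = 0 := by
  by_contra hL0
  let F : ℝ → ℝ := fun x => if x < 1 then u x else (x - 1)⁻¹
  have hF : IntervalIntegrable F volume a 1 := by
    have hIoo : IntegrableOn u (Ioo a 1) :=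
      (intervalIntegrable_iff_integrableOn_Ioo_of_le ha.le).1 hu
    refine (intervalIntegrable_iff_integrableOn_Ioo_of_le ha.le).2 (hIoo.congr_fun ?_ ?_)
    · intro x hx
      simp [F, hx.2]
    · exact measurableSet_Ioo
  refine not_intervalIntegrable_of_sub_inv_isBigO_punctured (c := 1) ?_ ha.ne right_mem_uIcc hF
  rw [← Iio_union_Ioi, nhdsWithin_union, isBigO_sup]
  constructor
  · have hbd : (fun _ : ℝ => (1 : ℝ)) =O[𝓝[<] 1] fun x => (1 - x) * u x :=
      (isBigO_const_left_iff_pos_le_norm one_ne_zero).2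
        ⟨|L| / 2, by positivity, by
          filter_upwards [hL.norm.eventually (lt_mem_nhds
            (show |L| / 2 < ‖L‖ by rw [Real.norm_eq_abs]; linarith [abs_pos.2 hL0]))]
            with x hx using hx.le⟩
    have hmul := (isBigO_refl (fun x : ℝ => (x - 1)⁻¹) (𝓝[<] 1)).mul hbd
    refine (hmul.congr_left fun x => mul_one _).trans (IsBigO.of_bound 1 ?_)
    filter_upwards [self_mem_nhdsWithin] with x hx
    have hx1 : x < 1 := hx
    have h : (x - 1)⁻¹ * ((1 - x) * u x) = -u x := by
      have : x - 1 ≠ 0 := by linarith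
      field_simp
      ring
    simp [F, hx1, h]
  · refine IsBigO.of_bound 1 ?_
    filter_upwards [self_mem_nhdsWithin] with x hx
    have hx1 : ¬ x < 1 := not_lt.2 (le_of_lt hx)
    simp [F, hx1]

open Filter Topology in
/-- Integration by parts against `1 - x`, with a possible singularity of `u` at `1`. -/
theorem integral_one_sub_mul_deriv {u u' : ℝ → ℝ} {a : ℝ} (ha : a < 1)
    (hderiv : ∀ x ∈ Ico a 1, HasDerivAt u (u' x) x)
    (hu : IntervalIntegrable u volume a 1)
    (hu' : IntervalIntegrable (fun x => (1 - x) * u' x) volume a 1) :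
    ∫ x in a..1, (1 - x) * u' x = -((1 - a) * u a) + ∫ x in a..1, u x := by
  let w : ℝ → ℝ := fun x => (1 - x) * u' x - u x
  have hw : IntervalIntegrable w volume a 1 := hu'.sub hu
  have hprim : Tendsto (fun x => ∫ t in a..x, w t) (𝓝[<] 1) (𝓝 (∫ t in a..1, w t)) := by
    have hcont : ContinuousOn (fun x => ∫ t in a..x, w t) (uIcc a 1) :=
      intervalIntegral.continuousOn_primitive_interval (by
        rwa [uIcc_of_le ha.le, ← intervalIntegrable_iff_integrableOn_Icc_of_le ha.le])
    refine (hcont 1 right_mem_uIcc).mono_left ?_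
    rw [uIcc_of_le ha.le, ← nhdsWithin_Ioo_eq_nhdsLT ha]
    exact nhdsWithin_mono _ Ioo_subset_Icc_self
  have hftc : ∀ x ∈ Ioo a 1, (1 - a) * u a + ∫ t in a..x, w t = (1 - x) * u x := by
    intro x hx
    have h := intervalIntegral.integral_eq_sub_of_hasDerivAt (a := a) (b := x)
      (f := fun t => (1 - t) * u t) (f' := w) (fun t ht => ?_)
      (hw.mono_set (by
        rw [uIcc_of_le hx.1.le, uIcc_of_le ha.le]
        exact Icc_subset_Icc_right hx.2.le))
    · rw [h]
      ring
    · rw [uIcc_of_le hx.1.le] at ht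
      have ht' := ((hasDerivAt_id t).const_sub 1).mul
        (hderiv t ⟨ht.1, ht.2.trans_lt hx.2⟩)
      refine ht'.congr_deriv ?_
      simp only [w, id]
      ring
  have hlim : Tendsto (fun x => (1 - x) * u x) (𝓝[<] 1)
      (𝓝 ((1 - a) * u a + ∫ t in a..1, w t)) := by
    refine (hprim.const_add _).congr' ?_
    filter_upwards [Ioo_mem_nhdsLT ha] with x hx using hftc x hx
  have hzero := eq_zero_of_tendsto_one_sub_mul ha hu hlim
  have hsub : ∫ t in a..1, w t = (∫ x in a..1, (1 - x) * u' x) - ∫ x in a..1, u x :=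
    intervalIntegral.integral_sub hu' hu
  linarith

theorem hasDerivAt_comp_one_sub {f : ℝ → ℝ} {x : ℝ} (hf : DifferentiableAt ℝ f (1 - x)) :
    HasDerivAt (fun y => f (1 - y)) (-deriv f (1 - x)) x := by
  simpa using hf.hasDerivAt.comp_const_sub 1 x

/-- The first-order condition satisfied by a differentiable weakly proper scoring rule. -/
theorem IsWeaklyProperRule.mul_deriv_eq_s5 {f : ℝ → ℝ} (hw : IsWeaklyProperRule f)
    (hf : DifferentiableOn ℝ f (Ioo 0 1)) {p : ℝ} (hp : p ∈ Ioo (0 : ℝ) 1) :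
    p * deriv f p = (1 - p) * deriv f (1 - p) := by
  have hq : 1 - p ∈ Ioo (0 : ℝ) 1 := ⟨by linarith [hp.2], by linarith [hp.1]⟩
  have hmax : IsLocalMax (fun x => p * f x + (1 - p) * f (1 - x)) p := by
    filter_upwards [Ioo_mem_nhds hp.1 hp.2] with x hx using hw p hp x hx
  have hd := hmax.hasDerivAt_eq_zero
    (((hf.differentiableAt (Ioo_mem_nhds hp.1 hp.2)).hasDerivAt.const_mul p).add
      ((hasDerivAt_comp_one_sub (hf.differentiableAt (Ioo_mem_nhds hq.1 hq.2))).const_mul (1 - p)))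
  linarith

/-- The envelope formula for the derivative of the reward function. -/
theorem IsWeaklyProperRule.hasDerivAt_rewardFn {f : ℝ → ℝ} (hw : IsWeaklyProperRule f)
    (hf : DifferentiableOn ℝ f (Ioo 0 1)) {p : ℝ} (hp : p ∈ Ioo (0 : ℝ) 1) :
    HasDerivAt (rewardFn f) (f p - f (1 - p)) p := by
  have hq : 1 - p ∈ Ioo (0 : ℝ) 1 := ⟨by linarith [hp.2], by linarith [hp.1]⟩
  have hd := ((hasDerivAt_id p).mul (hf.differentiableAt (Ioo_mem_nhds hp.1 hp.2)).hasDerivAt).add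
    (((hasDerivAt_id p).const_sub 1).mul
      (hasDerivAt_comp_one_sub (hf.differentiableAt (Ioo_mem_nhds hq.1 hq.2))))
  refine hd.congr_deriv ?_
  have := hw.mul_deriv_eq_s5 hf hp
  simp only [id]
  linarith

theorem rewardFn_one_sub (f : ℝ → ℝ) (x : ℝ) : rewardFn f (1 - x) = rewardFn f x := by
  simp only [rewardFn, sub_sub_cancel]
  ring

theorem integral_rewardFn (f : ℝ → ℝ) (hf : ContDiffOn ℝ 1 f (Set.Ioo 0 1))
    (hw : IsWeaklyProperRule f)
    (h1 : IntervalIntegrable (rewardFn f) volume 0 1)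
    (h2 : IntervalIntegrable f volume (1/2) 1)
    (h3 : IntervalIntegrable (fun x => (1 - x) * deriv f x) volume (1/2) 1) :
    (∫ x in (0:ℝ)..1, rewardFn f x) =
      f (1/2) + ∫ x in (1/2:ℝ)..1, (1 - x) * deriv f x ∧
    (∫ x in (0:ℝ)..1, rewardFn f x) =
      (1/2) * f (1/2) + ∫ x in (1/2:ℝ)..1, f x := by
  have hdiff : DifferentiableOn ℝ f (Ioo 0 1) := hf.differentiableOn one_ne_zero
  have hmem : ∀ x ∈ Ico (1 / 2 : ℝ) 1, x ∈ Ioo (0 : ℝ) 1 := fun x hx =>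
    ⟨by linarith [hx.1], hx.2⟩
  have hR : IntervalIntegrable (rewardFn f) volume (1/2) 1 := h1.mono_set (by
    rw [uIcc_of_le (by norm_num), uIcc_of_le (by norm_num)]
    exact Icc_subset_Icc_left (by norm_num))
  have hR0 : IntervalIntegrable (rewardFn f) volume 0 (1/2) := h1.mono_set (by
    rw [uIcc_of_le (by norm_num), uIcc_of_le (by norm_num)]
    exact Icc_subset_Icc_right (by norm_num))
  have hsymm : ∫ x in (0:ℝ)..(1/2), rewardFn f x = ∫ x in (1/2:ℝ)..1, rewardFn f x := by
    have h := intervalIntegral.integral_comp_sub_left (a := 0) (b := 1/2) (rewardFn f) 1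
    simp only [rewardFn_one_sub] at h
    rw [h]
    norm_num
  have hsplit := intervalIntegral.integral_add_adjacent_intervals hR0 hR
  have hrepr : (fun x => (1 - x) * (f x - f (1 - x))) = fun x => f x - rewardFn f x := by
    funext x
    simp only [rewardFn]
    ring
  have hpartsR := integral_one_sub_mul_deriv (by norm_num)
    (fun x hx => hw.hasDerivAt_rewardFn hdiff (hmem x hx)) hR
    (by rw [hrepr]; exact h2.sub hR)
  have hhalf : rewardFn f (1/2) = f (1/2) := by
    simp only [rewardFn]
    norm_num
    ring
  rw [hrepr, intervalIntegral.integral_sub h2 hR, hhalf] at hpartsR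
  have hpartsf := integral_one_sub_mul_deriv (by norm_num)
    (fun x hx => (hdiff.differentiableAt
      (Ioo_mem_nhds (hmem x hx).1 (hmem x hx).2)).hasDerivAt) h2 h3
  constructor <;> linarith
end

section
/- Let R : (0,1) → ℝ be twice differentiable. Let n, h be natural numbers with 0 ≤ h ≤ n, set q := (h+1)/(n+2), and define Δ := q·R((h+2)/(n+3)) + (1−q)·R((h+1)/(n+3)) − R(q). Then there exist c₁ ∈ [(h+1)/(n+3), (h+1)/(n+2)] and c₂ ∈ [(h+1)/(n+2), (h+2)/(n+3)] such that Δ = (q(1−q)/(2(n+3)²))·(q·R″(c₁) + (1−q)·R″(c₂)). -/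
open MeasureTheory Set

theorem exists_second_order_taylor_uIoo {f : ℝ → ℝ} {x₀ x : ℝ} (hne : x₀ ≠ x)
    (hf : ∀ t ∈ Set.uIcc x₀ x, DifferentiableAt ℝ f t ∧ DifferentiableAt ℝ (deriv f) t) :
    ∃ c ∈ Set.uIoo x₀ x,
      f x = f x₀ + deriv f x₀ * (x - x₀) + deriv (deriv f) c / 2 * (x - x₀) ^ 2 := by
  have hF : ∀ t ∈ Set.uIcc x₀ x, HasDerivAt (fun t => f t + deriv f t * (x - t))
      (deriv (deriv f) t * (x - t)) t := fun t ht => by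
    refine ((hf t ht).1.hasDerivAt.add
      ((hf t ht).2.hasDerivAt.mul ((hasDerivAt_id' t).const_sub x))).congr_deriv ?_
    ring
  have hG : ∀ t, HasDerivAt (fun t : ℝ => (x - t) ^ 2) (-2 * (x - t)) t := fun t => by
    refine (((hasDerivAt_id' t).const_sub x).pow 2).congr_deriv ?_
    norm_num
  obtain ⟨c, hc, heq⟩ := exists_ratio_hasDerivAt_eq_ratio_slope
    (fun t => f t + deriv f t * (x - t)) (fun t => deriv (deriv f) t * (x - t))
    (min_lt_max.2 hne) (fun t ht => (hF t ht).continuousAt.continuousWithinAt)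
    (fun t ht => hF t (Set.Ioo_subset_Icc_self ht))
    (fun t : ℝ => (x - t) ^ 2) (fun t => -2 * (x - t))
    (fun t _ => (hG t).continuousAt.continuousWithinAt) (fun t _ => hG t)
  refine ⟨c, hc, ?_⟩
  have hxc : x - c ≠ 0 := by
    rintro h
    obtain rfl : x = c := by linarith
    rcases hne.lt_or_gt with h | h <;> simp [h.le] at hc
  apply mul_left_cancel₀ hxc
  rcases hne.lt_or_gt with h | h
  · simp only [min_eq_left h.le, max_eq_right h.le] at heq
    linear_combination heq / 2
  · simp only [min_eq_right h.le, max_eq_left h.le] at heq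
    linear_combination -heq / 2

theorem delta_eq_second_deriv_form (R : ℝ → ℝ)
    (hd : ∀ x ∈ Set.Ioo (0:ℝ) 1, DifferentiableAt ℝ R x ∧ DifferentiableAt ℝ (deriv R) x)
    (n h : ℕ) (hh : h ≤ n) :
    ∃ c₁ ∈ Set.Icc (((h:ℝ) + 1) / ((n:ℝ) + 3)) (((h:ℝ) + 1) / ((n:ℝ) + 2)),
    ∃ c₂ ∈ Set.Icc (((h:ℝ) + 1) / ((n:ℝ) + 2)) (((h:ℝ) + 2) / ((n:ℝ) + 3)),
      (((h:ℝ) + 1) / ((n:ℝ) + 2)) * R (((h:ℝ) + 2) / ((n:ℝ) + 3))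
        + (1 - ((h:ℝ) + 1) / ((n:ℝ) + 2)) * R (((h:ℝ) + 1) / ((n:ℝ) + 3))
        - R (((h:ℝ) + 1) / ((n:ℝ) + 2))
      = (((h:ℝ) + 1) / ((n:ℝ) + 2)) * (1 - ((h:ℝ) + 1) / ((n:ℝ) + 2)) / (2 * ((n:ℝ) + 3) ^ 2)
        * ((((h:ℝ) + 1) / ((n:ℝ) + 2)) * deriv (deriv R) c₁
            + (1 - ((h:ℝ) + 1) / ((n:ℝ) + 2)) * deriv (deriv R) c₂) := by
  have hhn : (h : ℝ) ≤ n := by exact_mod_cast hh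
  have hh0 : (0 : ℝ) ≤ h := h.cast_nonneg
  have hn2 : (0 : ℝ) < n + 2 := by linarith
  have hn3 : (0 : ℝ) < n + 3 := by linarith
  have ha0 : (0 : ℝ) < (h + 1) / (n + 3) := by positivity
  have hb1 : ((h : ℝ) + 2) / (n + 3) < 1 := by rw [div_lt_one hn3]; linarith
  have hda : ((h : ℝ) + 1) / (n + 3) - (h + 1) / (n + 2)
      = -((h + 1) / (n + 2)) / (n + 3) := by field_simp; ring
  have hdb : ((h : ℝ) + 2) / (n + 3) - (h + 1) / (n + 2)
      = (1 - (h + 1) / (n + 2)) / (n + 3) := by field_simp; ring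
  have haq : ((h : ℝ) + 1) / (n + 3) < (h + 1) / (n + 2) := by gcongr; linarith
  have hqb : ((h : ℝ) + 1) / (n + 2) < (h + 2) / (n + 3) := by
    rw [div_lt_div_iff₀ hn2 hn3]; linarith
  generalize ((h : ℝ) + 1) / (n + 3) = a at *
  generalize ((h : ℝ) + 1) / (n + 2) = q at *
  generalize ((h : ℝ) + 2) / (n + 3) = b at *
  obtain ⟨c₁, hc₁, h₁⟩ := exists_second_order_taylor_uIoo (f := R) haq.ne' fun t ht => by
    rw [Set.uIcc_of_ge haq.le] at ht
    exact hd t ⟨ha0.trans_le ht.1, by linarith [ht.2]⟩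
  obtain ⟨c₂, hc₂, h₂⟩ := exists_second_order_taylor_uIoo (f := R) hqb.ne fun t ht => by
    rw [Set.uIcc_of_le hqb.le] at ht
    exact hd t ⟨by linarith [ht.1], ht.2.trans_lt hb1⟩
  rw [Set.uIoo_of_ge haq.le] at hc₁
  rw [Set.uIoo_of_le hqb.le] at hc₂
  refine ⟨c₁, Set.Ioo_subset_Icc_self hc₁, c₂, Set.Ioo_subset_Icc_self hc₂, ?_⟩
  rw [h₁, h₂, hda, hdb]
  field_simp
  ring
end

section
/- Let a > 0 and let R : (0,1) → ℝ be twice differentiable with R″(x) ≥ a for all x ∈ (0,1). Then for all natural numbers n ≥ 1 and 0 ≤ h ≤ n, setting q := (h+1)/(n+2) and Δ := q·R((h+2)/(n+3)) + (1−q)·R((h+1)/(n+3)) − R(q), one has Δ ≥ a/(72(n+1)³). -/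
open MeasureTheory Set

/-- A function whose second derivative is at least `m` on an open convex set is `m`-strongly
convex there. -/
theorem strongConvexOn_of_le_deriv2 {s : Set ℝ} (hs : Convex ℝ s) (hso : IsOpen s) {m : ℝ}
    {f : ℝ → ℝ} (hf : ∀ x ∈ s, DifferentiableAt ℝ f x)
    (hf' : ∀ x ∈ s, DifferentiableAt ℝ (deriv f) x)
    (hf'' : ∀ x ∈ s, m ≤ deriv (deriv f) x) : StrongConvexOn s m f := by
  rw [strongConvexOn_iff_convex]
  have h1 : ∀ x ∈ s, HasDerivAt (fun x ↦ f x - m / 2 * ‖x‖ ^ 2) (deriv f x - m * x) x := by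
    intro x hx
    simp only [Real.norm_eq_abs, sq_abs]
    refine ((hf x hx).hasDerivAt.fun_sub ((hasDerivAt_pow 2 x).const_mul (m / 2))).congr_deriv ?_
    norm_num
    ring
  have h2 : ∀ x ∈ s, HasDerivAt (fun x ↦ deriv f x - m * x) (deriv (deriv f) x - m) x := by
    intro x hx
    simpa using (hf' x hx).hasDerivAt.fun_sub ((hasDerivAt_id x).const_mul m)
  refine convexOn_of_hasDerivWithinAt2_nonneg hs
    (fun x hx ↦ (h1 x hx).continuousAt.continuousWithinAt)
    (f' := fun x ↦ deriv f x - m * x) (f'' := fun x ↦ deriv (deriv f) x - m) ?_ ?_ ?_ <;>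
    rw [hso.interior_eq]
  · exact fun x hx ↦ (h1 x hx).hasDerivWithinAt
  · exact fun x hx ↦ (h2 x hx).hasDerivWithinAt
  · exact fun x hx ↦ sub_nonneg.2 (hf'' x hx)

theorem delta_lower_bound (a : ℝ) (ha : 0 < a) (R : ℝ → ℝ)
    (hd : ∀ x ∈ Set.Ioo (0:ℝ) 1, DifferentiableAt ℝ R x ∧ DifferentiableAt ℝ (deriv R) x)
    (hconv : ∀ x ∈ Set.Ioo (0:ℝ) 1, a ≤ deriv (deriv R) x)
    (n h : ℕ) (hn : 1 ≤ n) (hh : h ≤ n) :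
    a / (72 * ((n:ℝ) + 1) ^ 3) ≤
      (((h:ℝ) + 1) / ((n:ℝ) + 2)) * R (((h:ℝ) + 2) / ((n:ℝ) + 3))
        + (1 - ((h:ℝ) + 1) / ((n:ℝ) + 2)) * R (((h:ℝ) + 1) / ((n:ℝ) + 3))
        - R (((h:ℝ) + 1) / ((n:ℝ) + 2)) := by
  have hR : StrongConvexOn (Ioo 0 1) a R :=
    strongConvexOn_of_le_deriv2 (convex_Ioo 0 1) isOpen_Ioo (fun x hx ↦ (hd x hx).1)
      (fun x hx ↦ (hd x hx).2) hconv
  have hn' : (1 : ℝ) ≤ n := by exact_mod_cast hn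
  have hh' : (h : ℝ) ≤ n := by exact_mod_cast hh
  have hh0 : (0 : ℝ) ≤ h := h.cast_nonneg
  generalize (n : ℝ) = N at *
  generalize (h : ℝ) = H at *
  have hx : (H + 2) / (N + 3) ∈ Ioo (0 : ℝ) 1 :=
    ⟨by positivity, by rw [div_lt_one (by linarith)]; linarith⟩
  have hy : (H + 1) / (N + 3) ∈ Ioo (0 : ℝ) 1 :=
    ⟨by positivity, by rw [div_lt_one (by linarith)]; linarith⟩
  have hq0 : 0 ≤ (H + 1) / (N + 2) := by positivity
  have hq1 : 0 ≤ 1 - (H + 1) / (N + 2) := by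
    rw [sub_nonneg, div_le_one (by linarith)]; linarith
  have key := hR.2 hx hy hq0 hq1 (by ring)
  have hmean : (H + 1) / (N + 2) * ((H + 2) / (N + 3))
      + (1 - (H + 1) / (N + 2)) * ((H + 1) / (N + 3)) = (H + 1) / (N + 2) := by
    field_simp
    ring
  have hdist : (H + 2) / (N + 3) - (H + 1) / (N + 3) = 1 / (N + 3) := by ring
  simp only [smul_eq_mul, hmean, hdist, Real.norm_eq_abs, sq_abs] at key
  have hgap : (H + 1) / (N + 2) * (1 - (H + 1) / (N + 2)) * (a / 2 * (1 / (N + 3)) ^ 2)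
      = a * ((H + 1) * (N - H + 1)) / (2 * ((N + 2) * (N + 3)) ^ 2) := by
    field_simp
    ring
  have hbound : a / (72 * (N + 1) ^ 3)
      ≤ a * ((H + 1) * (N - H + 1)) / (2 * ((N + 2) * (N + 3)) ^ 2) := calc
    a / (72 * (N + 1) ^ 3) = a * (N + 1) / (2 * (6 * (N + 1) ^ 2) ^ 2) := by
      field_simp
      ring
    _ ≤ a * ((H + 1) * (N - H + 1)) / (2 * ((N + 2) * (N + 3)) ^ 2) := by
      have hprod : 0 ≤ H * (N - H) := mul_nonneg hh0 (sub_nonneg.2 hh')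
      have hnum : N + 1 ≤ (H + 1) * (N - H + 1) := by linarith
      have hden : (N + 2) * (N + 3) ≤ 6 * (N + 1) ^ 2 := by nlinarith
      exact div_le_div₀ (mul_nonneg ha.le (by linarith)) (mul_le_mul_of_nonneg_left hnum ha.le)
        (by positivity)
        (mul_le_mul_of_nonneg_left (pow_le_pow_left₀ (by positivity) hden 2) zero_le_two)
  linarith
end

section
/- There exists a natural number N₀ with the following property: for every N ≥ N₀ and every sequence (r_i)_{i≥1} of elements of [0,1] such that for all integers n ≥ N and all integers 1 ≤ j ≤ n−1 one has |Q_{j/n}(n) − j/n| ≤ √(j(n−j))/(2·n^{1.49}), it holds that |Q_p(n) − p| ≤ √(p(1−p))/n^{0.49} for all integers n ≥ N and all real p ∈ [1/n, 1 − 1/n]. -/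
open MeasureTheory Set

/-- The number of the first `n` "coin flips" (indices `1 ≤ i ≤ n`) with `r i ≤ p`,
i.e. the number of heads among the first `n` flips of a coin with bias `p` realized
via the uniform sequence `r`. -/
noncomputable def headsCount (r : ℕ → ℝ) (p : ℝ) (n : ℕ) : ℕ :=
  ((Finset.Icc 1 n).filter (fun i => r i ≤ p)).card

/-- The expert's Bayesian estimate `Q_p(n) = (h_p(n) + 1) / (n + 2)`. -/
noncomputable def bayesEst (r : ℕ → ℝ) (p : ℝ) (n : ℕ) : ℝ :=
  ((headsCount r p n : ℝ) + 1) / ((n : ℝ) + 2)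

theorem headsCount_mono (r : ℕ → ℝ) (n : ℕ) {p q : ℝ} (h : p ≤ q) :
    headsCount r p n ≤ headsCount r q n :=
  Finset.card_le_card (Finset.monotone_filter_right _ fun _ _ hi => le_trans hi h)

theorem bayesEst_mono (r : ℕ → ℝ) (n : ℕ) {p q : ℝ} (h : p ≤ q) :
    bayesEst r p n ≤ bayesEst r q n := by
  have : (headsCount r p n : ℝ) ≤ headsCount r q n := by exact_mod_cast headsCount_mono r n h
  unfold bayesEst
  gcongr

theorem sqrt_mul_sub_div_eq {n : ℕ} (hn : 0 < n) (j : ℕ) :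
    Real.sqrt ((j:ℝ) * ((n:ℝ) - (j:ℝ))) / (2 * (n:ℝ) ^ (1.49:ℝ)) =
      Real.sqrt ((j:ℝ) / n * (1 - (j:ℝ) / n)) / (2 * (n:ℝ) ^ (0.49:ℝ)) := by
  have hn' : (0:ℝ) < n := by exact_mod_cast hn
  have h1 : (j:ℝ) * ((n:ℝ) - j) = (n:ℝ) ^ 2 * ((j:ℝ) / n * (1 - (j:ℝ) / n)) := by
    field_simp
  have h2 : (n:ℝ) ^ (1.49:ℝ) = n * (n:ℝ) ^ (0.49:ℝ) := by
    rw [show (1.49:ℝ) = 1 + 0.49 by norm_num, Real.rpow_add hn', Real.rpow_one]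
  have h3 : (0:ℝ) < (n:ℝ) ^ (0.49:ℝ) := by positivity
  rw [h1, h2, Real.sqrt_mul (by positivity), Real.sqrt_sq hn'.le]
  field_simp

/-- The standard deviation `√(x (1 - x))` grows by a factor of at most `3 / 2` over a distance `δ`
inside `[δ, 1 - δ]`. -/
theorem sqrt_mul_one_sub_le {δ p a : ℝ} (hδ : 0 ≤ δ) (hp : δ ≤ p) (hp' : p ≤ 1 - δ)
    (ha' : a ≤ 1 - δ) (h1 : a ≤ p + δ) (h2 : p ≤ a + δ) :
    Real.sqrt (a * (1 - a)) ≤ 3 / 2 * Real.sqrt (p * (1 - p)) := by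
  have key : a * (1 - a) ≤ 2 * (p * (1 - p)) := by
    rcases le_total a p with h | h
    · nlinarith [mul_le_mul h (by linarith : 1 - a ≤ 2 * (1 - p)) (by linarith) (by linarith)]
    · nlinarith [mul_le_mul (by linarith : a ≤ 2 * p) (by linarith : 1 - a ≤ 1 - p)
        (by linarith) (by linarith)]
  have hpos : 0 ≤ p * (1 - p) := mul_nonneg (by linarith) (by linarith)
  refine Real.sqrt_le_iff.2 ⟨by positivity, ?_⟩
  rw [mul_pow, Real.sq_sqrt hpos]
  linarith

theorem one_div_le_sqrt_div_rpow {n : ℕ} (hn : 2 ≤ n) (hbig : 6 ≤ (n:ℝ) ^ (0.01:ℝ)) {p : ℝ}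
    (hp : 1 / (n:ℝ) ≤ p) (hp' : p ≤ 1 - 1 / (n:ℝ)) :
    1 / (n:ℝ) ≤ Real.sqrt (p * (1 - p)) / (4 * (n:ℝ) ^ (0.49:ℝ)) := by
  have hn' : (0:ℝ) < n := by positivity
  have hn2 : (2:ℝ) ≤ n := by exact_mod_cast hn
  have hD : (0:ℝ) < (n:ℝ) ^ (0.49:ℝ) := by positivity
  have hprod : (n:ℝ) ^ (0.01:ℝ) * (n:ℝ) ^ (0.49:ℝ) = Real.sqrt n := by
    rw [← Real.rpow_add hn', Real.sqrt_eq_rpow]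
    norm_num
  have hsq := Real.sq_sqrt hn'.le
  have hle : 6 * (n:ℝ) ^ (0.49:ℝ) ≤ Real.sqrt n := by
    rw [← hprod]
    gcongr
  have hδ : 1 / (n:ℝ) ≤ 1 / 2 := one_div_le_one_div_of_le (by norm_num) hn2
  have hvar : 1 / (n:ℝ) / 2 ≤ p * (1 - p) := by
    have hδ0 : 0 < 1 / (n:ℝ) := by positivity
    nlinarith [mul_nonneg (sub_nonneg.2 hp) (sub_nonneg.2 hp')]
  have hD2 : 36 * ((n:ℝ) ^ (0.49:ℝ)) ^ 2 ≤ n := by nlinarith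
  rw [le_div_iff₀ (by positivity)]
  refine Real.le_sqrt_of_sq_le (le_trans ?_ hvar)
  rw [mul_pow, div_pow, div_mul_eq_mul_div, div_div, div_le_div_iff₀ (by positivity) (by positivity)]
  nlinarith

theorem omega_implies_uniform_closeness :
    ∃ N₀ : ℕ, ∀ N : ℕ, N₀ ≤ N → ∀ r : ℕ → ℝ, (∀ i, r i ∈ Set.Icc (0:ℝ) 1) →
      (∀ n : ℕ, N ≤ n → ∀ j : ℕ, 1 ≤ j → j ≤ n - 1 →
        |bayesEst r ((j:ℝ) / (n:ℝ)) n - (j:ℝ) / (n:ℝ)| ≤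
          Real.sqrt ((j:ℝ) * ((n:ℝ) - (j:ℝ))) / (2 * (n:ℝ) ^ (1.49:ℝ))) →
      ∀ n : ℕ, N ≤ n → ∀ p : ℝ, 1 / (n:ℝ) ≤ p → p ≤ 1 - 1 / (n:ℝ) →
        |bayesEst r p n - p| ≤ Real.sqrt (p * (1 - p)) / (n:ℝ) ^ (0.49:ℝ) := by
  have hlim : Filter.Tendsto (fun n : ℕ => (n:ℝ) ^ (0.01:ℝ)) Filter.atTop Filter.atTop :=
    (tendsto_rpow_atTop (by norm_num)).comp tendsto_natCast_atTop_atTop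
  obtain ⟨N₁, hN₁⟩ := Filter.eventually_atTop.1 (hlim.eventually_ge_atTop 6)
  refine ⟨max 2 N₁, fun N hN r _ hgrid n hn p hp hp' => ?_⟩
  have hn2 : 2 ≤ n := (le_max_left _ _).trans (hN.trans hn)
  have hn' : (0:ℝ) < n := by positivity
  have hn0 : (n:ℝ) ≠ 0 := hn'.ne'
  have hD : (0:ℝ) < (n:ℝ) ^ (0.49:ℝ) := by positivity
  have hsmall := one_div_le_sqrt_div_rpow hn2
    (hN₁ n ((le_max_right _ _).trans (hN.trans hn))) hp hp'
  have hgrid_near : ∀ j : ℕ, 1 ≤ j → j ≤ n - 1 → (j:ℝ) / n ≤ p + 1 / n → p ≤ (j:ℝ) / n + 1 / n →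
      |bayesEst r ((j:ℝ) / n) n - (j:ℝ) / n| ≤
        3 / 4 * (Real.sqrt (p * (1 - p)) / (n:ℝ) ^ (0.49:ℝ)) := by
    intro j hj hj' h1 h2
    refine (hgrid n hn j hj hj').trans ?_
    rw [sqrt_mul_sub_div_eq (by omega)]
    have hj2 : (j:ℝ) / n ≤ 1 - 1 / n := by
      have : (j:ℝ) + 1 ≤ n := by exact_mod_cast (by omega : j + 1 ≤ n)
      rw [le_sub_iff_add_le, ← add_div]
      exact (div_le_one hn').2 this
    have := sqrt_mul_one_sub_le (by positivity) hp hp' hj2 h1 h2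
    calc _ ≤ 3 / 2 * Real.sqrt (p * (1 - p)) / (2 * (n:ℝ) ^ (0.49:ℝ)) := by gcongr
      _ = _ := by ring
  have hsmall' : 1 / (n:ℝ) ≤ 1 / 4 * (Real.sqrt (p * (1 - p)) / (n:ℝ) ^ (0.49:ℝ)) :=
    hsmall.trans_eq (by ring)
  have hpn : 1 ≤ p * n := (div_le_iff₀ hn').1 hp
  have hpn' : p * n ≤ (n - 1 : ℕ) := by
    rw [Nat.cast_sub (by omega), Nat.cast_one]
    calc p * n ≤ (1 - 1 / n) * n := by gcongr
      _ = n - 1 := by field_simp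
  have hp0 : 0 ≤ p * n := by linarith
  have hfl : (⌊p * n⌋₊ : ℝ) / n ≤ p := (div_le_iff₀ hn').2 (Nat.floor_le hp0)
  have hfl' : p ≤ (⌊p * n⌋₊ : ℝ) / n + 1 / n := by
    rw [← add_div]
    exact (le_div_iff₀ hn').2 (Nat.lt_floor_add_one _).le
  have hce : p ≤ (⌈p * n⌉₊ : ℝ) / n := (le_div_iff₀ hn').2 (Nat.le_ceil _)
  have hce' : (⌈p * n⌉₊ : ℝ) / n ≤ p + 1 / n := by
    rw [div_le_iff₀ hn', add_mul, div_mul_cancel₀ _ hn0]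
    exact (Nat.ceil_lt_add_one hp0).le
  have hδ : 0 < 1 / (n:ℝ) := by positivity
  have hlow := hgrid_near ⌊p * n⌋₊ (Nat.le_floor (by simpa using hpn))
    (Nat.cast_le.1 ((Nat.floor_le hp0).trans hpn')) (by linarith) hfl'
  have hup := hgrid_near ⌈p * n⌉₊ (Nat.one_le_ceil_iff.2 (by linarith))
    (Nat.ceil_le.2 hpn') hce' (by linarith)
  have hmono := bayesEst_mono r n hfl
  have hmono' := bayesEst_mono r n hce
  rw [abs_le] at hlow hup ⊢
  constructor <;> linarith
end

section
/- Let p ∈ ℝ, ε ∈ ℝ, r ≥ 0, and let I be the closed interval with endpoints p and p+ε. Let R be a real function that is three times differentiable on an open set containing I with continuous third derivative there, and suppose R″(x) > 0 and |R‴(x)| ≤ r·R″(x) for all x ∈ I. Then |R″(p+ε) − R″(p)| ≤ R″(p)·(e^{r|ε|} − 1). -/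
open MeasureTheory Set

/-- Grönwall's inequality for the increment of `f` along the segment from `p` to `p + ε`, when the
logarithmic derivative of `f` is bounded by `r`. -/
theorem abs_sub_le_mul_exp_sub_one_of_abs_deriv_le {f f' : ℝ → ℝ} {p ε r : ℝ} (hr : 0 ≤ r)
    (hp : 0 ≤ f p) (hf : ∀ x ∈ Set.uIcc p (p + ε), HasDerivAt f (f' x) x)
    (hbound : ∀ x ∈ Set.uIcc p (p + ε), |f' x| ≤ r * |f x|) :
    |f (p + ε) - f p| ≤ f p * (Real.exp (r * |ε|) - 1) := by
  have hmem : ∀ t ∈ Set.Icc (0 : ℝ) 1, p + t * ε ∈ Set.uIcc p (p + ε) := by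
    rintro t ⟨ht0, ht1⟩
    rw [← segment_eq_uIcc]
    exact ⟨1 - t, t, by linarith, ht0, by ring, by simp only [smul_eq_mul]; ring⟩
  have hderiv : ∀ t ∈ Set.Icc (0 : ℝ) 1,
      HasDerivAt (fun t ↦ f (p + t * ε) - f p) (f' (p + t * ε) * ε) t := by
    intro t ht
    have hline : HasDerivAt (fun t : ℝ ↦ p + t * ε) ε t := by
      simpa using ((hasDerivAt_id t).mul_const ε).const_add p
    exact ((hf _ (hmem t ht)).comp t hline).sub_const (f p)
  have hgron := norm_le_gronwallBound_of_norm_deriv_right_le (δ := 0) (K := r * |ε|)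
    (ε := r * |ε| * f p)
    (fun t ht ↦ (hderiv t ht).continuousAt.continuousWithinAt)
    (fun t ht ↦ (hderiv t (Set.Ico_subset_Icc_self ht)).hasDerivWithinAt)
    (by simp)
    (by
      intro t ht
      have hb := hbound _ (hmem t (Set.Ico_subset_Icc_self ht))
      have htri : |f (p + t * ε)| ≤ |f (p + t * ε) - f p| + f p := by
        simpa [abs_of_nonneg hp] using abs_add_le (f (p + t * ε) - f p) (f p)
      rw [Real.norm_eq_abs, Real.norm_eq_abs, abs_mul]
      calc |f' (p + t * ε)| * |ε| ≤ r * (|f (p + t * ε) - f p| + f p) * |ε| := by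
            gcongr
            exact hb.trans (by gcongr)
        _ = r * |ε| * |f (p + t * ε) - f p| + r * |ε| * f p := by ring)
    1 (by simp)
  rw [one_mul, Real.norm_eq_abs] at hgron
  refine hgron.trans_eq ?_
  rcases eq_or_ne (r * |ε|) 0 with h0 | h0
  · simp [h0, gronwallBound_K0]
  · rw [gronwallBound_of_K_ne_0 h0]
    simp only [zero_mul, zero_add, sub_zero, mul_one]
    rw [mul_div_cancel_left₀ _ h0]

theorem gronwall_second_deriv (p ε r : ℝ) (hr : 0 ≤ r) (R : ℝ → ℝ) (U : Set ℝ)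
    (hU : IsOpen U) (hIU : Set.uIcc p (p + ε) ⊆ U) (hR : ContDiffOn ℝ 3 R U)
    (hpos : ∀ x ∈ Set.uIcc p (p + ε), 0 < deriv (deriv R) x)
    (hbound : ∀ x ∈ Set.uIcc p (p + ε),
      |deriv (deriv (deriv R)) x| ≤ r * deriv (deriv R) x) :
    |deriv (deriv R) (p + ε) - deriv (deriv R) p| ≤
      deriv (deriv R) p * (Real.exp (r * |ε|) - 1) := by
  have h1 : ContDiffOn ℝ 2 (deriv R) U := hR.deriv_of_isOpen hU (by norm_num)
  have h2 : ContDiffOn ℝ 1 (deriv (deriv R)) U := h1.deriv_of_isOpen hU (by norm_num)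
  refine abs_sub_le_mul_exp_sub_one_of_abs_deriv_le (f' := deriv (deriv (deriv R))) hr
    (hpos p Set.left_mem_uIcc).le (fun x hx ↦ ?_) (fun x hx ↦ ?_)
  · exact ((h2.differentiableOn one_ne_zero).differentiableAt
      (hU.mem_nhds (hIU hx))).hasDerivAt
  · rw [abs_of_pos (hpos x hx)]
    exact hbound x hx
end

section
/- Fix a real ℓ ≥ 1 and let κ_ℓ := (∫_{1/2}^1 (x(1−x)³)^{ℓ/(ℓ+4)} dx)^{−1} and h̃_ℓ(x) := κ_ℓ·(x^ℓ (1−x)^{2ℓ−4})^{1/(ℓ+4)} for x ∈ [1/2, 1). Then ∫_{1/2}^1 (1−x)·h̃_ℓ(x) dx = 1, and for every measurable function h : [1/2, 1) → (0,∞) satisfying ∫_{1/2}^1 (1−x)·h(x) dx = 1, one has ∫_{1/2}^1 (x(1−x)²/h̃_ℓ(x))^{ℓ/4} dx ≤ ∫_{1/2}^1 (x(1−x)²/h(x))^{ℓ/4} dx (where the integrals of the nonnegative objective are interpreted in [0,∞]). -/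
open MeasureTheory Set
open scoped ENNReal

/-- The normalization constant `κ_ℓ`. -/
noncomputable def kappa (ℓ : ℝ) : ℝ :=
  (∫ x in Set.Ico (1/2 : ℝ) 1, (x * (1 - x) ^ (3:ℕ)) ^ (ℓ / (ℓ + 4)))⁻¹

/-- The optimal derivative `h̃_ℓ(x) = κ_ℓ (x^ℓ (1-x)^{2ℓ-4})^{1/(ℓ+4)}`. -/
noncomputable def hTilde (ℓ : ℝ) : ℝ → ℝ := fun x =>
  kappa ℓ * (x ^ ℓ * (1 - x) ^ (2 * ℓ - 4)) ^ (1 / (ℓ + 4))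

/-- The objective `∫_{1/2}^1 (x(1-x)²/h(x))^{ℓ/4} dx`, valued in `[0,∞]`. -/
noncomputable def objective (ℓ : ℝ) (h : ℝ → ℝ) : ℝ≥0∞ :=
  ∫⁻ x in Set.Ico (1/2 : ℝ) 1,
    (ENNReal.ofReal (x * (1 - x) ^ (2:ℕ)) / ENNReal.ofReal (h x)) ^ (ℓ / 4)

/-- The tangent-line inequality for the convex function `t ↦ t ^ (-a)` at `t = 1`. -/
lemma one_add_sub_mul_le_rpow_neg {a t : ℝ} (ha : 0 ≤ a) (ht : 0 < t) :
    1 + a - a * t ≤ t ^ (-a) := by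
  have h1 : Real.log t ≤ t - 1 := Real.log_le_sub_one_of_pos ht
  have h2 := Real.add_one_le_exp (Real.log t * -a)
  rw [Real.rpow_def_of_pos ht]
  nlinarith [mul_le_mul_of_nonneg_left h1 ha]

lemma integral_rpow_weight_pos {p : ℝ} (hp : 0 ≤ p) :
    0 < ∫ x in Set.Ico (1/2 : ℝ) 1, (x * (1 - x) ^ (3:ℕ)) ^ p := by
  have hc : Continuous fun x : ℝ => (x * (1 - x) ^ (3:ℕ)) ^ p :=
    (by fun_prop : Continuous fun x : ℝ => x * (1 - x) ^ (3:ℕ)).rpow_const fun _ => Or.inr hp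
  rw [integral_Ico_eq_integral_Ioc, ← intervalIntegral.integral_of_le (by norm_num)]
  refine intervalIntegral.intervalIntegral_pos_of_pos_on (hc.intervalIntegrable _ _) ?_
    (by norm_num)
  intro x hx
  have hx0 : 0 < x := by linarith [hx.1]
  have hy0 : 0 < 1 - x := by linarith [hx.2]
  positivity

lemma kappa_pos {ℓ : ℝ} (hℓ : 0 ≤ ℓ) : 0 < kappa ℓ :=
  inv_pos.2 (integral_rpow_weight_pos (by positivity))

lemma hTilde_pos {ℓ x : ℝ} (hℓ : 0 ≤ ℓ) (hx : x ∈ Set.Ico (1/2 : ℝ) 1) : 0 < hTilde ℓ x := by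
  have hx0 : 0 < x := by linarith [hx.1]
  have hy0 : 0 < 1 - x := by linarith [hx.2]
  have := kappa_pos hℓ
  unfold hTilde
  positivity

lemma one_sub_mul_hTilde {ℓ x : ℝ} (hℓ : 0 ≤ ℓ) (hx : x ∈ Set.Ico (1/2 : ℝ) 1) :
    (1 - x) * hTilde ℓ x = kappa ℓ * (x * (1 - x) ^ (3:ℕ)) ^ (ℓ / (ℓ + 4)) := by
  have hx0 : 0 < x := by linarith [hx.1]
  have hy0 : 0 < 1 - x := by linarith [hx.2]
  unfold hTilde
  rw [Real.mul_rpow (by positivity) (by positivity), Real.mul_rpow (by positivity) (by positivity),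
    ← Real.rpow_mul hx0.le, ← Real.rpow_mul hy0.le, ← Real.rpow_natCast (1 - x) 3,
    ← Real.rpow_mul hy0.le]
  have hexp : ((3:ℕ) : ℝ) * (ℓ / (ℓ + 4)) = 1 + (2 * ℓ - 4) * (1 / (ℓ + 4)) := by
    push_cast
    field_simp
    ring
  rw [hexp, Real.rpow_add hy0, Real.rpow_one, mul_one_div ℓ]
  ring

lemma integral_one_sub_mul_hTilde {ℓ : ℝ} (hℓ : 0 ≤ ℓ) :
    (∫ x in Set.Ico (1/2 : ℝ) 1, (1 - x) * hTilde ℓ x) = 1 := by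
  rw [setIntegral_congr_fun measurableSet_Ico fun x hx => one_sub_mul_hTilde hℓ hx,
    integral_const_mul]
  exact inv_mul_cancel₀ (integral_rpow_weight_pos (by positivity)).ne'

/-- The Euler–Lagrange equation satisfied by `hTilde`. -/
lemma div_hTilde_rpow {ℓ x : ℝ} (hℓ : 0 ≤ ℓ) (hx : x ∈ Set.Ico (1/2 : ℝ) 1) :
    (x * (1 - x) ^ (2:ℕ) / hTilde ℓ x) ^ (ℓ / 4) =
      kappa ℓ ^ (-(1 + ℓ / 4)) * ((1 - x) * hTilde ℓ x) := by
  have hx0 : 0 < x := by linarith [hx.1]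
  have hy0 : 0 < 1 - x := by linarith [hx.2]
  have hk := kappa_pos hℓ
  have ht := hTilde_pos hℓ hx
  have key : hTilde ℓ x ^ (1 + ℓ / 4) =
      kappa ℓ ^ (1 + ℓ / 4) * (x ^ (ℓ / 4) * (1 - x) ^ (ℓ / 2 - 1)) := by
    unfold hTilde
    have hexp : 1 / (ℓ + 4) * (1 + ℓ / 4) = 1 / 4 := by
      field_simp
      ring
    rw [Real.mul_rpow hk.le (by positivity), ← Real.rpow_mul (by positivity), hexp,
      Real.mul_rpow (by positivity) (by positivity), ← Real.rpow_mul hx0.le,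
      ← Real.rpow_mul hy0.le]
    ring_nf
  rw [Real.rpow_add ht, Real.rpow_one] at key
  rw [Real.div_rpow (by positivity) ht.le, Real.mul_rpow hx0.le (by positivity),
    ← Real.rpow_natCast (1 - x) 2, ← Real.rpow_mul hy0.le, Real.rpow_neg hk.le,
    div_eq_iff (by positivity)]
  have hexp : ((2:ℕ) : ℝ) * (ℓ / 4) = 1 + (ℓ / 2 - 1) := by
    push_cast
    ring
  have hK : kappa ℓ ^ (1 + ℓ / 4) ≠ 0 := by positivity
  rw [hexp, Real.rpow_add hy0, Real.rpow_one]
  calc x ^ (ℓ / 4) * ((1 - x) * (1 - x) ^ (ℓ / 2 - 1))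
      = (kappa ℓ ^ (1 + ℓ / 4))⁻¹ * (1 - x) *
          (kappa ℓ ^ (1 + ℓ / 4) * (x ^ (ℓ / 4) * (1 - x) ^ (ℓ / 2 - 1))) := by
        field_simp
    _ = _ := by
        rw [← key]
        ring

lemma objective_eq_lintegral_ofReal {ℓ : ℝ} {h : ℝ → ℝ}
    (hpos : ∀ x ∈ Set.Ico (1/2 : ℝ) 1, 0 < h x) :
    objective ℓ h = ∫⁻ x in Set.Ico (1/2 : ℝ) 1,
      ENNReal.ofReal ((x * (1 - x) ^ (2:ℕ) / h x) ^ (ℓ / 4)) := by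
  refine setLIntegral_congr_fun measurableSet_Ico fun x hx => ?_
  have hx0 : 0 < x := by linarith [hx.1]
  have hy0 : 0 < 1 - x := by linarith [hx.2]
  have hh := hpos x hx
  rw [← ENNReal.ofReal_div_of_pos hh, ENNReal.ofReal_rpow_of_pos (by positivity)]

lemma lintegral_ofReal_mul_one_sub_mul {h : ℝ → ℝ}
    (hpos : ∀ x ∈ Set.Ico (1/2 : ℝ) 1, 0 < h x)
    (hint : (∫ x in Set.Ico (1/2 : ℝ) 1, (1 - x) * h x) = 1) {c : ℝ} (hc : 0 ≤ c) :
    ∫⁻ x in Set.Ico (1/2 : ℝ) 1, ENNReal.ofReal (c * ((1 - x) * h x)) = ENNReal.ofReal c := by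
  have hi : IntegrableOn (fun x => (1 - x) * h x) (Set.Ico (1/2 : ℝ) 1) := by
    by_contra hn
    exact zero_ne_one ((integral_undef hn).symm.trans hint)
  rw [← ofReal_integral_eq_lintegral_ofReal (hi.const_mul c), integral_const_mul, hint, mul_one]
  filter_upwards [ae_restrict_mem measurableSet_Ico] with x hx
  have hy0 : 0 < 1 - x := by linarith [hx.2]
  have := hpos x hx
  positivity

lemma objective_hTilde {ℓ : ℝ} (hℓ : 0 ≤ ℓ) :
    objective ℓ (hTilde ℓ) = ENNReal.ofReal (kappa ℓ ^ (-(1 + ℓ / 4))) := by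
  have hpos : ∀ x ∈ Set.Ico (1/2 : ℝ) 1, 0 < hTilde ℓ x := fun x hx => hTilde_pos hℓ hx
  have hk := kappa_pos hℓ
  rw [objective_eq_lintegral_ofReal hpos,
    ← lintegral_ofReal_mul_one_sub_mul hpos (integral_one_sub_mul_hTilde hℓ)
      (by positivity : 0 ≤ kappa ℓ ^ (-(1 + ℓ / 4)))]
  refine setLIntegral_congr_fun measurableSet_Ico fun x hx => ?_
  rw [div_hTilde_rpow hℓ hx]

/-- The pointwise convexity bound of the integrand at `hTilde`. -/
lemma mul_hTilde_le_div_rpow_add {ℓ x y : ℝ} (hℓ : 0 ≤ ℓ) (hx : x ∈ Set.Ico (1/2 : ℝ) 1)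
    (hy : 0 < y) :
    (1 + ℓ / 4) * kappa ℓ ^ (-(1 + ℓ / 4)) * ((1 - x) * hTilde ℓ x) ≤
      (x * (1 - x) ^ (2:ℕ) / y) ^ (ℓ / 4) +
        ℓ / 4 * kappa ℓ ^ (-(1 + ℓ / 4)) * ((1 - x) * y) := by
  have hx0 : 0 < x := by linarith [hx.1]
  have hy0 : 0 < 1 - x := by linarith [hx.2]
  have hk := kappa_pos hℓ
  have ht := hTilde_pos hℓ hx
  have htan := one_add_sub_mul_le_rpow_neg (by positivity : 0 ≤ ℓ / 4) (div_pos hy ht)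
  have hfac : (x * (1 - x) ^ (2:ℕ) / y) ^ (ℓ / 4) =
      kappa ℓ ^ (-(1 + ℓ / 4)) * ((1 - x) * hTilde ℓ x) * (y / hTilde ℓ x) ^ (-(ℓ / 4)) := by
    rw [← div_hTilde_rpow hℓ hx, Real.rpow_neg (by positivity), ← Real.inv_rpow (by positivity),
      ← Real.mul_rpow (by positivity) (by positivity)]
    congr 1
    field_simp
  have hmul := mul_le_mul_of_nonneg_left htan
    (by positivity : 0 ≤ kappa ℓ ^ (-(1 + ℓ / 4)) * ((1 - x) * hTilde ℓ x))
  rw [← hfac] at hmul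
  have hexpand : kappa ℓ ^ (-(1 + ℓ / 4)) * ((1 - x) * hTilde ℓ x) *
      (1 + ℓ / 4 - ℓ / 4 * (y / hTilde ℓ x)) =
      (1 + ℓ / 4) * kappa ℓ ^ (-(1 + ℓ / 4)) * ((1 - x) * hTilde ℓ x) -
        ℓ / 4 * kappa ℓ ^ (-(1 + ℓ / 4)) * ((1 - x) * y) := by
    have hdiv : hTilde ℓ x * (y / hTilde ℓ x) = y := mul_div_cancel₀ y ht.ne'
    linear_combination (-(ℓ / 4 * kappa ℓ ^ (-(1 + ℓ / 4)) * (1 - x))) * hdiv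
  linarith

theorem hTilde_minimizes (ℓ : ℝ) (hℓ : 1 ≤ ℓ) :
    (∫ x in Set.Ico (1/2 : ℝ) 1, (1 - x) * hTilde ℓ x) = 1 ∧
    ∀ h : ℝ → ℝ, Measurable h → (∀ x ∈ Set.Ico (1/2 : ℝ) 1, 0 < h x) →
      (∫ x in Set.Ico (1/2 : ℝ) 1, (1 - x) * h x) = 1 →
      objective ℓ (hTilde ℓ) ≤ objective ℓ h := by
  have hℓ0 : 0 ≤ ℓ := zero_le_one.trans hℓ
  refine ⟨integral_one_sub_mul_hTilde hℓ0, fun h hmeas hpos hint => ?_⟩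
  have hk := kappa_pos hℓ0
  have hC : 0 ≤ kappa ℓ ^ (-(1 + ℓ / 4)) := by positivity
  have haC : 0 ≤ ℓ / 4 * kappa ℓ ^ (-(1 + ℓ / 4)) := by positivity
  rw [objective_hTilde hℓ0]
  refine (ENNReal.add_le_add_iff_right
    (ENNReal.ofReal_ne_top (r := ℓ / 4 * kappa ℓ ^ (-(1 + ℓ / 4))))).1 ?_
  calc ENNReal.ofReal (kappa ℓ ^ (-(1 + ℓ / 4))) +
        ENNReal.ofReal (ℓ / 4 * kappa ℓ ^ (-(1 + ℓ / 4)))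
      = ENNReal.ofReal ((1 + ℓ / 4) * kappa ℓ ^ (-(1 + ℓ / 4))) := by
        rw [← ENNReal.ofReal_add hC haC]
        ring_nf
    _ = ∫⁻ x in Set.Ico (1/2 : ℝ) 1,
          ENNReal.ofReal ((1 + ℓ / 4) * kappa ℓ ^ (-(1 + ℓ / 4)) * ((1 - x) * hTilde ℓ x)) :=
        (lintegral_ofReal_mul_one_sub_mul (fun x hx => hTilde_pos hℓ0 hx)
          (integral_one_sub_mul_hTilde hℓ0) (by positivity)).symm
    _ ≤ ∫⁻ x in Set.Ico (1/2 : ℝ) 1,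
          (ENNReal.ofReal ((x * (1 - x) ^ (2:ℕ) / h x) ^ (ℓ / 4)) +
            ENNReal.ofReal (ℓ / 4 * kappa ℓ ^ (-(1 + ℓ / 4)) * ((1 - x) * h x))) :=
        setLIntegral_mono' measurableSet_Ico fun x hx =>
          (ENNReal.ofReal_le_ofReal (mul_hTilde_le_div_rpow_add hℓ0 hx (hpos x hx))).trans
            ENNReal.ofReal_add_le
    _ = objective ℓ h + ENNReal.ofReal (ℓ / 4 * kappa ℓ ^ (-(1 + ℓ / 4))) := by
        rw [lintegral_add_right _ (by fun_prop), ← objective_eq_lintegral_ofReal hpos,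
          lintegral_ofReal_mul_one_sub_mul hpos hint haC]
end
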